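/- Let X be a Hausdorff topological space and let x : ω₁ → X be an injective map whose range D = {x_α : α < ω₁} is a closed discrete subset of X. Define E₀ = X and E_α = {x_η : α ≤ η < ω₁} for 0 < α < ω₁. Then the family {E_α : α < ω₁} is a closed subset of (CL(X), τ_F). -/

import Mathlib

open Set Topology Ordinal

noncomputable section

/-- `CL X` is the hyperspace of nonempty closed subsets of `X`. -/
def CL (X : Type*) [TopologicalSpace X] : Type _ := {A : Set X // A.Nonempty ∧ IsClosed A}

/-- The Fell topology on `CL X`, generated by the subbase consisting of the sets
`U⁻ = {A : A ∩ U ≠ ∅}` for `U` open and `(Kᶜ)⁺ = {A : A ⊆ Kᶜ}` for `K` compact. -/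
def fellTopology (X : Type*) [TopologicalSpace X] : TopologicalSpace (CL X) :=
  TopologicalSpace.generateFrom
    ({S | ∃ U : Set X, IsOpen U ∧ S = {A : CL X | (A.1 ∩ U).Nonempty}} ∪
     {S | ∃ K : Set X, IsCompact K ∧ S = {A : CL X | A.1 ⊆ Kᶜ}})


/-- Every subset of a closed discrete set is closed. -/
theorem IsClosed.isClosed_of_subset_of_discreteTopology {X : Type*} [TopologicalSpace X]
    {D S : Set X} (hD : IsClosed D) [DiscreteTopology D] (hS : S ⊆ D) : IsClosed S := by
  rw [← Subtype.range_coe (s := D)] at hS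
  rw [← Set.image_preimage_eq_of_subset hS]
  exact hD.isClosedEmbedding_subtypeVal.isClosedMap _ (isClosed_discrete _)

/-- A family of closed sets is closed in the Fell topology if every `A` outside it admits an open
set `U` meeting `A` and a point `p ∉ A` contained in each member of the family that meets `U`. -/
theorem isClosed_fellTopology_of_separation {X : Type*} [TopologicalSpace X] {F : Set (CL X)}
    (h : ∀ A ∉ F, ∃ U : Set X, IsOpen U ∧ ∃ p ∉ A.1, (A.1 ∩ U).Nonempty ∧
      ∀ B ∈ F, (B.1 ∩ U).Nonempty → p ∈ B.1) :
    @IsClosed _ (fellTopology X) F := by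
  let := fellTopology X
  rw [← isOpen_compl_iff, isOpen_iff_forall_mem_open]
  intro A hA
  obtain ⟨U, hU, p, hp, hAU, hF⟩ := h A hA
  have h₁ : IsOpen {B : CL X | (B.1 ∩ U).Nonempty} :=
    TopologicalSpace.isOpen_generateFrom_of_mem (Or.inl ⟨U, hU, rfl⟩)
  have h₂ : IsOpen {B : CL X | B.1 ⊆ {p}ᶜ} :=
    TopologicalSpace.isOpen_generateFrom_of_mem (Or.inr ⟨{p}, isCompact_singleton, rfl⟩)
  exact ⟨_, fun B hB hBF => hB.2 (hF B hBF hB.1) rfl, h₁.inter h₂, hAU,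
    Set.subset_compl_singleton_iff.2 hp⟩

/-- Let `x : ω₁ → X` be injective with closed discrete range, `E₀ = X` and
`E_α = {x_η : α ≤ η < ω₁}` for `0 < α < ω₁`. Then `{E_α : α < ω₁}` is a closed
subset of `(CL X, τ_F)`. -/
theorem range_phi_isClosed_fell {X : Type*} [TopologicalSpace X] [T2Space X]
    (x : Ordinal → X) (hx_inj : Set.InjOn x (Set.Iio ω₁))
    (hD_closed : IsClosed (x '' Set.Iio ω₁))
    (hD_disc : DiscreteTopology (x '' Set.Iio ω₁))
    (φ : {o : Ordinal // o < ω₁} → CL X)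
    (hφ_zero : ∀ α : {o : Ordinal // o < ω₁}, α.1 = 0 → (φ α).1 = Set.univ)
    (hφ_pos : ∀ α : {o : Ordinal // o < ω₁}, α.1 ≠ 0 →
      (φ α).1 = x '' Set.Ico α.1 ω₁) :
    @IsClosed _ (fellTopology X) (Set.range φ) := by
  have hsub : ∀ S ⊆ Set.Iio (ω₁ : Ordinal), IsClosed (x '' S) := fun S hS =>
    hD_closed.isClosed_of_subset_of_discreteTopology (Set.image_mono hS)
  refine isClosed_fellTopology_of_separation fun A hA => ?_
  have hA_ne : A.1 ≠ Set.univ := fun h =>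
    hA ⟨⟨0, omega_pos 1⟩, Subtype.ext ((hφ_zero _ rfl).trans h.symm)⟩
  obtain ⟨p, hp⟩ := (Set.ne_univ_iff_exists_notMem _).1 hA_ne
  by_cases hAD : A.1 ⊆ x '' Set.Iio ω₁
  · obtain ⟨a, ha⟩ := A.2.1
    obtain ⟨α, ⟨hα, hαA⟩, hmin⟩ : ∃ α, (α < ω₁ ∧ x α ∈ A.1) ∧ ∀ β, β < ω₁ → x β ∈ A.1 → α ≤ β := by
      obtain ⟨η, hη, rfl⟩ := hAD ha
      let S : Set Ordinal := {β | β < ω₁ ∧ x β ∈ A.1}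
      have hS : S.Nonempty := ⟨η, hη, ha⟩
      exact ⟨sInf S, csInf_mem hS, fun β h₁ h₂ => csInf_le' (show β ∈ S from ⟨h₁, h₂⟩)⟩
    have hAα : A.1 ⊆ x '' Set.Ico α ω₁ := by
      intro b hb
      obtain ⟨η, hη, rfl⟩ := hAD hb
      exact ⟨η, ⟨hmin η hη hb, hη⟩, rfl⟩
    obtain ⟨q, hqA, hq⟩ : ∃ q ∉ A.1, α ≠ 0 → q ∈ x '' Set.Ico α ω₁ := by
      by_cases h0 : α = 0
      · exact ⟨p, hp, fun h => absurd h0 h⟩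
      · by_contra! hcon
        refine hA ⟨⟨α, hα⟩, Subtype.ext ((hφ_pos _ h0).trans (Set.Subset.antisymm ?_ hAα))⟩
        intro b hb
        by_contra hbA
        exact (hcon b hbA).2 hb
    refine ⟨(x '' Set.Ioo α ω₁)ᶜ, (hsub _ fun _ h => h.2).isOpen_compl, q, hqA,
      ⟨x α, hαA, ?_⟩, ?_⟩
    · rintro ⟨η, hη, he⟩
      exact hη.1.ne' (hx_inj hη.2 hα he)
    · rintro _ ⟨β, rfl⟩ ⟨b, hb, hbU⟩
      by_cases hβ : β.1 = 0
      · rw [hφ_zero β hβ]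
        exact Set.mem_univ q
      · rw [hφ_pos β hβ] at hb ⊢
        obtain ⟨η, hη, rfl⟩ := hb
        have hηα : η ≤ α := not_lt.1 fun h => hbU ⟨η, ⟨h, hη.2⟩, rfl⟩
        have hβα : β.1 ≤ α := hη.1.trans hηα
        have hα0 : α ≠ 0 := fun h => hβ (le_antisymm (h ▸ hβα) zero_le)
        exact Set.image_mono (Set.Ico_subset_Ico_left hβα) (hq hα0)
  · obtain ⟨a, ha, haD⟩ := Set.not_subset.1 hAD
    refine ⟨(x '' Set.Iio ω₁)ᶜ, hD_closed.isOpen_compl, p, hp, ⟨a, ha, haD⟩, ?_⟩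
    rintro _ ⟨β, rfl⟩ ⟨b, hb, hbU⟩
    by_cases hβ : β.1 = 0
    · rw [hφ_zero β hβ]
      exact Set.mem_univ p
    · rw [hφ_pos β hβ] at hb
      exact absurd (Set.image_mono (fun _ h => h.2) hb) hbU
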